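/- Let λ > 0, v > 0, t > 0 and let p ≥ 1 be a natural number. Then λt ∫_{-vt}^{vt} x^p I₁((λ/v)√(v²t² − x²)) / √(v²t² − x²) dx = (1 + (−1)^p) (vt)^p { (2/(λt))^{(p−1)/2} Γ((p+1)/2) I_{(p−1)/2}(λt) − 1 }. -/

import Mathlib

open Real

/-- The modified Bessel function of the first kind,
`I_ν(x) = ∑_{k=0}^∞ (x/2)^{2k+ν} / (Γ(k+1+ν) k!)`. -/
noncomputable def besselI (ν x : ℝ) : ℝ :=
  ∑' k : ℕ, (x / 2) ^ (2 * (k : ℝ) + ν) / (Real.Gamma ((k : ℝ) + 1 + ν) * (Nat.factorial k))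

theorem besselI_one_mul_div (c : ℝ) {s : ℝ} (hs : 0 < s) (k : ℕ) :
    (c * s / 2) ^ (2 * (k : ℝ) + 1) / (Real.Gamma ((k : ℝ) + 1 + 1) * (Nat.factorial k)) / s
      = (c / 2) ^ (2 * k + 1) * (s ^ 2) ^ k / ((Nat.factorial (k + 1)) * (Nat.factorial k)) := by
  have h1 : (2 * (k : ℝ) + 1) = ((2 * k + 1 : ℕ) : ℝ) := by push_cast; ring
  have h2 : Real.Gamma ((k : ℝ) + 1 + 1) = (Nat.factorial (k + 1) : ℝ) := by
    rw [← Real.Gamma_nat_eq_factorial (k + 1)]; push_cast; rfl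
  rw [h2, h1, Real.rpow_natCast]
  have hf : (Nat.factorial (k + 1) : ℝ) ≠ 0 := by positivity
  have hg : (Nat.factorial k : ℝ) ≠ 0 := by positivity
  rw [show c * s / 2 = c / 2 * s by ring, mul_pow, ← pow_mul, pow_succ s (2 * k)]
  field_simp

theorem summable_pow_div_factorial_mul_factorial (y : ℝ) :
    Summable fun k : ℕ => y ^ k / ((Nat.factorial (k + 1) : ℝ) * (Nat.factorial k)) := by
  refine Summable.of_norm_bounded (Real.summable_pow_div_factorial |y|) fun k => ?_
  rw [Real.norm_eq_abs, abs_div, abs_pow,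
    abs_of_pos (by positivity : 0 < (Nat.factorial (k + 1) : ℝ) * (Nat.factorial k))]
  refine div_le_div_of_nonneg_left (by positivity) (by positivity) ?_
  refine le_mul_of_one_le_left (by positivity) ?_
  exact_mod_cast Nat.one_le_iff_ne_zero.mpr (Nat.factorial_ne_zero _)

theorem hasSum_besselI_one_div (c : ℝ) {s : ℝ} (hs : 0 < s) :
    HasSum (fun k : ℕ => (c / 2) ^ (2 * k + 1) * (s ^ 2) ^ k /
      ((Nat.factorial (k + 1)) * (Nat.factorial k))) (besselI 1 (c * s) / s) := by
  have h : besselI 1 (c * s) / s = ∑' k : ℕ, (c / 2) ^ (2 * k + 1) * (s ^ 2) ^ k /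
      ((Nat.factorial (k + 1)) * (Nat.factorial k)) := by
    rw [besselI, ← tsum_div_const]
    exact tsum_congr fun k => besselI_one_mul_div c hs k
  rw [h]
  refine Summable.hasSum ?_
  refine ((summable_pow_div_factorial_mul_factorial ((c / 2) ^ 2 * s ^ 2)).mul_left
    (c / 2)).congr fun k => ?_
  rw [mul_pow, pow_succ (c / 2) (2 * k), pow_mul]
  ring

theorem integral_pow_mul_sq_sub_sq_pow (R : ℝ) (k : ℕ) : ∀ p : ℕ,
    ∫ x in (-R)..R, x ^ p * (R ^ 2 - x ^ 2) ^ k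
      = (1 + (-1 : ℝ) ^ p) / 2 * R ^ (p + 2 * k + 1) * Real.Gamma (((p : ℝ) + 1) / 2) *
        (Nat.factorial k) / Real.Gamma (((p : ℝ) + 1) / 2 + k + 1) := by
  induction k with
  | zero =>
    intro p
    have ha : 0 < ((p : ℝ) + 1) / 2 := by positivity
    have hG := (Real.Gamma_pos_of_pos ha).ne'
    simp only [pow_zero, mul_one, integral_pow, Nat.cast_zero, add_zero, Nat.factorial_zero,
      Nat.cast_one, mul_zero, Real.Gamma_add_one ha.ne']
    rw [neg_pow R, pow_succ (-1 : ℝ)]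
    field_simp
    ring
  | succ k ih =>
    intro p
    have hderiv : ∀ x : ℝ, HasDerivAt (fun x : ℝ => x ^ (p + 1) * (R ^ 2 - x ^ 2) ^ (k + 1))
        (((p : ℝ) + 1) * (x ^ p * (R ^ 2 - x ^ 2) ^ (k + 1)) -
          2 * ((k : ℝ) + 1) * (x ^ (p + 2) * (R ^ 2 - x ^ 2) ^ k)) x := by
      intro x
      have h1 := hasDerivAt_pow (p + 1) x
      have h2 := ((hasDerivAt_pow 2 x).const_sub (R ^ 2)).pow (k + 1)
      refine (h1.mul h2).congr_deriv ?_
      simp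
      ring
    have hint := intervalIntegral.integral_eq_sub_of_hasDerivAt (a := -R) (b := R)
      (fun x _ => hderiv x) (Continuous.intervalIntegrable (by fun_prop) _ _)
    rw [intervalIntegral.integral_sub (Continuous.intervalIntegrable (by fun_prop) _ _)
      (Continuous.intervalIntegrable (by fun_prop) _ _), intervalIntegral.integral_const_mul,
      intervalIntegral.integral_const_mul, ih (p + 2)] at hint
    have ha : 0 < ((p : ℝ) + 1) / 2 := by positivity
    have e1 : (((p + 2 : ℕ) : ℝ) + 1) / 2 = ((p : ℝ) + 1) / 2 + 1 := by push_cast; ring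
    have e2 : ((p : ℝ) + 1) / 2 + ((k + 1 : ℕ) : ℝ) + 1 = ((p : ℝ) + 1) / 2 + 1 + k + 1 := by
      push_cast; ring
    have hG : Real.Gamma (((p : ℝ) + 1) / 2 + 1 + k + 1) ≠ 0 :=
      (Real.Gamma_pos_of_pos (by positivity)).ne'
    have hp : (p : ℝ) + 1 ≠ 0 := by positivity
    rw [e1, Real.Gamma_add_one ha.ne'] at hint
    rw [e2, Nat.factorial_succ]
    refine mul_left_cancel₀ hp ?_
    simp only [neg_sq, sub_self, ne_eq, not_false_eq_true, zero_pow,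
      mul_zero, add_eq_zero, one_ne_zero, and_false] at hint
    rw [sub_eq_zero.mp hint, pow_add (-1 : ℝ) p 2]
    push_cast
    field_simp
    ring

theorem hasSum_integral_pow_mul_besselI_one {c R : ℝ} (hc : 0 < c) (hR : 0 < R) (p : ℕ) :
    HasSum (fun k : ℕ => (c / 2) ^ (2 * k + 1) / ((Nat.factorial (k + 1)) * (Nat.factorial k)) *
        ∫ x in (-R)..R, x ^ p * (R ^ 2 - x ^ 2) ^ k)
      (∫ x in (-R)..R, x ^ p * besselI 1 (c * Real.sqrt (R ^ 2 - x ^ 2)) /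
        Real.sqrt (R ^ 2 - x ^ 2)) := by
  simp_rw [← intervalIntegral.integral_const_mul]
  refine intervalIntegral.hasSum_integral_of_dominated_convergence
    (fun k _ => (c / 2) ^ (2 * k + 1) / ((Nat.factorial (k + 1)) * (Nat.factorial k)) *
      (R ^ p * (R ^ 2) ^ k)) (fun k => Continuous.aestronglyMeasurable (by fun_prop)) ?_ ?_ ?_ ?_
  · refine fun k => Filter.Eventually.of_forall fun x hx => ?_
    rw [Set.uIoc_of_le (by linarith)] at hx
    have hxR : |x| ≤ R := abs_le.mpr ⟨hx.1.le, hx.2⟩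
    have hsq : x ^ 2 ≤ R ^ 2 := sq_le_sq' hx.1.le hx.2
    rw [norm_mul, Real.norm_of_nonneg (by positivity), norm_mul, norm_pow, norm_pow,
      Real.norm_eq_abs x, Real.norm_of_nonneg (sub_nonneg.mpr hsq)]
    have h0 : 0 ≤ R ^ 2 - x ^ 2 := sub_nonneg.mpr hsq
    have h1 : R ^ 2 - x ^ 2 ≤ R ^ 2 := by linarith [sq_nonneg x]
    gcongr
  · refine Filter.Eventually.of_forall fun x _ => ?_
    refine ((summable_pow_div_factorial_mul_factorial ((c / 2) ^ 2 * R ^ 2)).mul_left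
      (c / 2 * R ^ p)).congr fun k => ?_
    rw [mul_pow, pow_succ (c / 2) (2 * k), pow_mul]
    ring
  · exact intervalIntegrable_const
  · filter_upwards [MeasureTheory.Measure.ae_ne MeasureTheory.volume R] with x hne hx
    rw [Set.uIoc_of_le (by linarith)] at hx
    have hpos : 0 < R ^ 2 - x ^ 2 :=
      sub_pos.mpr (sq_lt_sq' hx.1 (lt_of_le_of_ne hx.2 hne))
    have h := (hasSum_besselI_one_div c (Real.sqrt_pos.mpr hpos)).mul_left (x ^ p)
    rw [Real.sq_sqrt hpos.le] at h
    rw [mul_div_assoc]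
    exact h.congr_fun fun k => by ring

theorem two_div_rpow_mul_besselI {a z : ℝ} (hz : 0 < z) :
    (2 / z) ^ (a - 1) * besselI (a - 1) z
      = ∑' k : ℕ, (z / 2) ^ (2 * k) / (Real.Gamma (a + k) * (Nat.factorial k)) := by
  rw [besselI, ← tsum_mul_left]
  refine tsum_congr fun k => ?_
  have hz2 : 0 < z / 2 := by positivity
  rw [Real.rpow_add hz2, show (2 * (k : ℝ)) = ((2 * k : ℕ) : ℝ) by push_cast; rfl,
    Real.rpow_natCast, show (k : ℝ) + 1 + (a - 1) = a + k by ring, ← inv_div z 2,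
    Real.inv_rpow hz2.le]
  have : (z / 2) ^ (a - 1) ≠ 0 := (Real.rpow_pos_of_pos hz2 _).ne'
  field_simp

/-- `λt ∫_{-vt}^{vt} x^p I₁((λ/v)√(v²t² − x²)) / √(v²t² − x²) dx
  = (1 + (−1)^p) (vt)^p { (2/(λt))^{(p−1)/2} Γ((p+1)/2) I_{(p−1)/2}(λt) − 1 }`. -/
theorem stmt_2 (l v t : ℝ) (hl : 0 < l) (hv : 0 < v) (ht : 0 < t)
    (p : ℕ) (hp : 1 ≤ p) :
    (l * t) * ∫ x in (-(v * t))..(v * t),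
        x ^ p * besselI 1 ((l / v) * Real.sqrt (v ^ 2 * t ^ 2 - x ^ 2)) /
          Real.sqrt (v ^ 2 * t ^ 2 - x ^ 2)
      = (1 + (-1 : ℝ) ^ p) * (v * t) ^ p *
          ((2 / (l * t)) ^ (((p : ℝ) - 1) / 2) * Real.Gamma (((p : ℝ) + 1) / 2) *
              besselI (((p : ℝ) - 1) / 2) (l * t) - 1) := by
  have hR : 0 < v * t := by positivity
  have hz : 0 < l * t := by positivity
  have ha : 0 < ((p : ℝ) + 1) / 2 := by positivity
  have hG := (Real.Gamma_pos_of_pos ha).ne'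
  set g : ℕ → ℝ := fun k =>
    (l * t / 2) ^ (2 * k) / (Real.Gamma (((p : ℝ) + 1) / 2 + k) * (Nat.factorial k)) with hg
  set C : ℝ := (1 + (-1 : ℝ) ^ p) * (v * t) ^ p * Real.Gamma (((p : ℝ) + 1) / 2) with hC
  have hterm := (hasSum_integral_pow_mul_besselI_one (div_pos hl hv) hR p).mul_left (l * t)
  have hshift : ∀ k : ℕ, l * t * ((l / v / 2) ^ (2 * k + 1) /
      ((Nat.factorial (k + 1)) * (Nat.factorial k)) *
        ∫ x in (-(v * t))..(v * t), x ^ p * ((v * t) ^ 2 - x ^ 2) ^ k) = C * g (k + 1) := by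
    intro k
    have hG' : Real.Gamma (((p : ℝ) + 1) / 2 + k + 1) ≠ 0 :=
      (Real.Gamma_pos_of_pos (by positivity)).ne'
    rw [integral_pow_mul_sq_sub_sq_pow, hC, hg]
    simp only [Nat.cast_add, Nat.cast_one, ← add_assoc]
    have hpow : l * t / 2 = l / v / 2 * (v * t) := by field_simp
    rw [hpow, show l * t = 2 * (l / v / 2 * (v * t)) by field_simp]
    generalize l / v / 2 = q
    generalize v * t = R
    field_simp
    ring
  simp_rw [hshift] at hterm
  rw [← mul_pow, ← hterm.tsum_eq]
  by_cases hC0 : C = 0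
  · have h1 : (1 + (-1 : ℝ) ^ p) = 0 := by
      simpa [hC, hG, hR.ne', hv.ne', ht.ne'] using hC0
    simp [hC0, h1]
  have hsum : Summable fun k => g (k + 1) := (summable_mul_left_iff hC0).mp hterm.summable
  have hz0 := ((summable_nat_add_iff 1).mp hsum).tsum_eq_zero_add
  have hg0 : g 0 = 1 / Real.Gamma (((p : ℝ) + 1) / 2) := by simp [hg]
  have hb := two_div_rpow_mul_besselI (a := ((p : ℝ) + 1) / 2) hz
  rw [show ((p : ℝ) + 1) / 2 - 1 = ((p : ℝ) - 1) / 2 by ring] at hb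
  rw [mul_right_comm ((2 / (l * t)) ^ (((p : ℝ) - 1) / 2)), hb, hz0, hg0, tsum_mul_left, hC]
  field_simp
  ring
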